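/- Let Q be a quiver of type D_4 (one central vertex with three neighbors, any orientation). Up to isomorphism, there is exactly one indecomposable representation of Q that is not thin, namely the representation with dimension vector having value 2 at the central vertex and 1 at each of the three outer vertices. -/

import Mathlib

/-! A minimal framework for representations of a quiver with vertex set `V`,
arrow set `E` and source/target maps `s t : E → V`, over a field `k`. -/

structure QRep (k : Type) [Field k] {V E : Type} (s t : E → V) where
  space : V → Type
  [acg : ∀ v, AddCommGroup (space v)]
  [mod : ∀ v, Module k (space v)]
  map : ∀ e : E, space (s e) →ₗ[k] space (t e)

attribute [instance] QRep.acg QRep.mod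

namespace QRep

variable {k : Type} [Field k] {V E : Type} {s t : E → V}

/-- An isomorphism of representations: compatible linear equivalences at every vertex. -/
structure Iso (M N : QRep k s t) where
  app : ∀ v, M.space v ≃ₗ[k] N.space v
  comm : ∀ (e : E) (x : M.space (s e)), app (t e) (M.map e x) = N.map e (app (s e) x)

/-- The (binary) direct sum of two representations. -/
def prod (M N : QRep k s t) : QRep k s t where
  space v := M.space v × N.space v
  acg v := inferInstanceAs (AddCommGroup (M.space v × N.space v))
  mod v := inferInstanceAs (Module k (M.space v × N.space v))
  map e := (M.map e).prodMap (N.map e)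

/-- The direct sum of an arbitrary family of representations. -/
noncomputable def dsum {ι : Type} (F : ι → QRep k s t) : QRep k s t :=
  letI := Classical.decEq ι
  { space := fun v => DirectSum ι fun i => (F i).space v
    acg := fun v => inferInstanceAs (AddCommGroup (DirectSum ι fun i => (F i).space v))
    mod := fun v => inferInstanceAs (Module k (DirectSum ι fun i => (F i).space v))
    map := fun e => DirectSum.toModule k ι (DirectSum ι fun i => (F i).space (t e))
      fun i => (DirectSum.lof k ι (fun j => (F j).space (t e)) i).comp ((F i).map e) }

/-- The zero representation predicate. -/
def IsZero (M : QRep k s t) : Prop := ∀ (v : V) (x : M.space v), x = 0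

/-- A representation is indecomposable if it is nonzero and any direct sum
decomposition has a zero summand. -/
def Indecomposable (M : QRep k s t) : Prop :=
  ¬ M.IsZero ∧ ∀ N₁ N₂ : QRep k s t, Nonempty (Iso M (N₁.prod N₂)) → N₁.IsZero ∨ N₂.IsZero

/-- A representation is thin if all vertex spaces have dimension at most `1`. -/
def Thin (M : QRep k s t) : Prop := ∀ v : V, Module.rank k (M.space v) ≤ 1

/-- All vertex spaces are finite-dimensional. -/
def FinDim (M : QRep k s t) : Prop := ∀ v : V, FiniteDimensional k (M.space v)

end QRep

/-- The representation `M(Q)`: the field `k` at every vertex, identity at every arrow. -/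
def constRep (k : Type) [Field k] {V E : Type} (s t : E → V) : QRep k s t where
  space _ := k
  acg _ := inferInstanceAs (AddCommGroup k)
  mod _ := inferInstanceAs (Module k k)
  map _ := LinearMap.id

/-- The canonical map `(PLift P → k) → (PLift Q → k)`: the identity if `P` holds
(the two spaces both being `k` then), and zero otherwise. -/
noncomputable def restrictMap (k : Type) [Field k] (P Q : Prop) : (PLift P → k) →ₗ[k] (PLift Q → k) :=
  letI := Classical.propDecidable P
  { toFun := fun v _ => if h : P then v ⟨h⟩ else 0
    map_add' := by
      intro a b; funext hq; by_cases hP : P <;> simp [hP]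
    map_smul' := by
      intro c a; funext hq; by_cases hP : P <;> simp [hP] }

/-- The thin representation `M(Q')` attached to a set `S` of vertices (full subquiver on `S`):
one-dimensional spaces on `S`, zero outside, identity maps on arrows inside `S`,
zero maps elsewhere. -/
noncomputable def subsetRep (k : Type) [Field k] {V E : Type} (s t : E → V) (S : Set V) : QRep k s t where
  space v := PLift (v ∈ S) → k
  acg v := inferInstanceAs (AddCommGroup (PLift (v ∈ S) → k))
  mod v := inferInstanceAs (Module k (PLift (v ∈ S) → k))
  map e := restrictMap k (s e ∈ S) (t e ∈ S)

/-- The underlying (simple) graph of a quiver. -/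
def underlying {V E : Type} (s t : E → V) : SimpleGraph V :=
  SimpleGraph.fromRel fun a b => ∃ e, s e = a ∧ t e = b

/-- Source map of a quiver of type `D₄`: central vertex `0`, leaves `1, 2, 3`, one arrow
between `0` and each leaf, oriented according to `d`. -/
def sD (d : Fin 3 → Bool) : Fin 3 → Fin 4 := fun e => if d e then 0 else e.succ

/-- Target map of the `D₄` quiver. -/
def tD (d : Fin 3 → Bool) : Fin 3 → Fin 4 := fun e => if d e then e.succ else 0

namespace QRep

section General

variable {k : Type} [Field k] {V E : Type} {s t : E → V}

/-- The subrepresentation carried by a family of subspaces stable under all arrows. -/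
def sub (M : QRep k s t) (A : ∀ v, Submodule k (M.space v))
    (hA : ∀ e, ∀ x ∈ A (s e), M.map e x ∈ A (t e)) : QRep k s t where
  space v := A v
  map e := (M.map e).restrict (hA e)

/-- The splitting of a vector space as the range plus the kernel of an idempotent. -/
def idempotentSplitting {V : Type} [AddCommGroup V] [Module k V] (p : V →ₗ[k] V)
    (hp : ∀ x, p (p x) = p x) : V ≃ₗ[k] LinearMap.range p × LinearMap.ker p where
  toFun x := (⟨p x, x, rfl⟩, ⟨x - p x, by simp [hp]⟩)
  invFun y := y.1 + y.2
  map_add' x y := by ext <;> simp [add_sub_add_comm]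
  map_smul' c x := by ext <;> simp [smul_sub]
  left_inv x := by simp
  right_inv := by
    rintro ⟨⟨_, x, rfl⟩, ⟨y, hy⟩⟩
    rw [LinearMap.mem_ker] at hy
    ext <;> simp [hp, hy]

/-- A representation is indecomposable iff it is nonzero and its only idempotent endomorphisms
are `0` and `1`. -/
theorem indecomposable_iff_idempotent (M : QRep k s t) :
    M.Indecomposable ↔ ¬ M.IsZero ∧ ∀ p : ∀ v, M.space v →ₗ[k] M.space v,
      (∀ v x, p v (p v x) = p v x) →
      (∀ e x, p (t e) (M.map e x) = M.map e (p (s e) x)) →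
      (∀ v x, p v x = 0) ∨ (∀ v x, p v x = x) := by
  refine and_congr_right fun _ => ⟨fun hM p hp hc => ?_, fun hM N₁ N₂ ⟨f⟩ => ?_⟩
  · let N₁ := M.sub (fun v => LinearMap.range (p v)) (by
      rintro e _ ⟨x, rfl⟩
      exact ⟨M.map e x, hc e x⟩)
    let N₂ := M.sub (fun v => LinearMap.ker (p v)) (by
      intro e x hx
      rw [LinearMap.mem_ker] at hx ⊢
      rw [hc, hx, map_zero])
    have key : Nonempty (Iso M (N₁.prod N₂)) := by
      refine ⟨⟨fun v => idempotentSplitting (p v) (hp v), fun e x => ?_⟩⟩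
      refine Prod.ext (Subtype.ext (hc e x)) (Subtype.ext ?_)
      change M.map e x - p _ (M.map e x) = M.map e (x - p _ x)
      rw [hc, map_sub]
    refine (hM N₁ N₂ key).imp (fun h v x => ?_) fun h v x => ?_
    · exact congrArg Subtype.val (h v ⟨p v x, x, rfl⟩)
    · have hx : x - p v x ∈ LinearMap.ker (p v) := by simp [hp]
      exact (sub_eq_zero.mp (congrArg Subtype.val (h v ⟨_, hx⟩))).symm
  · let F : ∀ v, M.space v ≃ₗ[k] N₁.space v × N₂.space v := fun v => f.app v
    have hF : ∀ e x, F (t e) (M.map e x) = (N₁.map e (F (s e) x).1, N₂.map e (F (s e) x).2) :=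
      f.comm
    let p : ∀ v, M.space v →ₗ[k] M.space v := fun v =>
      (F v).symm.toLinearMap ∘ₗ LinearMap.inl k _ _ ∘ₗ LinearMap.fst k _ _ ∘ₗ (F v).toLinearMap
    have hpF : ∀ v x, F v (p v x) = ((F v x).1, 0) := fun v x => by simp [p]
    refine (hM p (fun v x => (F v).injective ?_) fun e x => (F _).injective ?_).imp
      (fun h v y => ?_) fun h v y => ?_
    · simp [hpF]
    · simp [hpF, hF]
    · have := hpF v ((F v).symm (y, 0))
      simpa [h] using this.symm
    · have := hpF v ((F v).symm (0, y))
      simpa [h] using this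

/-- The structure map of an arrow, with prescribed endpoints. -/
def arrow (M : QRep k s t) {e : E} {a b : V} (hs : s e = a) (ht : t e = b) :
    M.space a →ₗ[k] M.space b :=
  match a, b, hs, ht with
  | _, _, rfl, rfl => M.map e

theorem comm_iff_arrow {M N : QRep k s t} {e : E} {a b : V} (hs : s e = a) (ht : t e = b)
    (φ : ∀ v, M.space v →ₗ[k] N.space v) :
    (∀ x, φ (t e) (M.map e x) = N.map e (φ (s e) x)) ↔
      ∀ x, φ b (M.arrow hs ht x) = N.arrow hs ht (φ a x) := by
  subst hs ht
  rfl

end General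

section D4

variable {k : Type} [Field k] {d : Fin 3 → Bool}

theorem sD_of_true {i : Fin 3} (h : d i = true) : sD d i = 0 := by simp [sD, h]
theorem tD_of_true {i : Fin 3} (h : d i = true) : tD d i = i.succ := by simp [tD, h]
theorem sD_of_false {i : Fin 3} (h : d i = false) : sD d i = i.succ := by simp [sD, h]
theorem tD_of_false {i : Fin 3} (h : d i = false) : tD d i = 0 := by simp [tD, h]

/-- The structure map of an arm oriented from the center to the leaf. -/
def outArm (M : QRep k (sD d) (tD d)) {i : Fin 3} (h : d i = true) :
    M.space 0 →ₗ[k] M.space i.succ :=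
  M.arrow (sD_of_true h) (tD_of_true h)

/-- The structure map of an arm oriented from the leaf to the center. -/
def inArm (M : QRep k (sD d) (tD d)) {i : Fin 3} (h : d i = false) :
    M.space i.succ →ₗ[k] M.space 0 :=
  M.arrow (sD_of_false h) (tD_of_false h)

/-- The `i`-th arm of `M` is surjective if it points outwards, injective if it points inwards. -/
def RegularAt (M : QRep k (sD d) (tD d)) (i : Fin 3) : Prop :=
  (∀ h : d i = true, Function.Surjective (M.outArm h)) ∧
    ∀ h : d i = false, Function.Injective (M.inArm h)

/-- The subspace of the central space determined by the `i`-th arm: the kernel of an outgoing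
map, the range of an incoming one. -/
def armSubspace (M : QRep k (sD d) (tD d)) (i : Fin 3) : Submodule k (M.space 0) :=
  (⨅ h : d i = true, LinearMap.ker (M.outArm h)) ⊓ ⨅ h : d i = false, LinearMap.range (M.inArm h)

theorem mem_armSubspace_of_true (M : QRep k (sD d) (tD d)) {i : Fin 3} (h : d i = true)
    {x : M.space 0} : x ∈ M.armSubspace i ↔ M.outArm h x = 0 := by
  simp [armSubspace, h]

theorem mem_armSubspace_of_false (M : QRep k (sD d) (tD d)) {i : Fin 3} (h : d i = false)
    {x : M.space 0} : x ∈ M.armSubspace i ↔ ∃ y, M.inArm h y = x := by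
  simp [armSubspace, h]

/-- Linear maps at the center and at the `i`-th leaf are compatible with the `i`-th arm. -/
def ArmComm (M N : QRep k (sD d) (tD d)) (i : Fin 3) (φ : M.space 0 →ₗ[k] N.space 0)
    (ψ : M.space i.succ →ₗ[k] N.space i.succ) : Prop :=
  (∀ h x, ψ (M.outArm h x) = N.outArm h (φ x)) ∧ ∀ h x, φ (M.inArm h x) = N.inArm h (ψ x)

variable {M N P : QRep k (sD d) (tD d)} {i : Fin 3}

theorem comm_iff_armComm (φ : ∀ v, M.space v →ₗ[k] N.space v) :
    (∀ x, φ (tD d i) (M.map i x) = N.map i (φ (sD d i) x)) ↔ ArmComm M N i (φ 0) (φ i.succ) := by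
  cases h : d i
  · rw [comm_iff_arrow (sD_of_false h) (tD_of_false h)]
    simp [ArmComm, h, inArm]
  · rw [comm_iff_arrow (sD_of_true h) (tD_of_true h)]
    simp [ArmComm, h, outArm]

theorem ArmComm.id : ArmComm M M i LinearMap.id LinearMap.id := ⟨by simp, by simp⟩

theorem ArmComm.comp {φ : M.space 0 →ₗ[k] N.space 0} {ψ : M.space i.succ →ₗ[k] N.space i.succ}
    {φ' : N.space 0 →ₗ[k] P.space 0} {ψ' : N.space i.succ →ₗ[k] P.space i.succ}
    (h' : ArmComm N P i φ' ψ') (h : ArmComm M N i φ ψ) :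
    ArmComm M P i (φ' ∘ₗ φ) (ψ' ∘ₗ ψ) :=
  ⟨fun hd x => by simp [h.1, h'.1], fun hd x => by simp [h.2, h'.2]⟩

theorem ArmComm.map_mem {φ : M.space 0 →ₗ[k] N.space 0}
    {ψ : M.space i.succ →ₗ[k] N.space i.succ} (h : ArmComm M N i φ ψ) {x : M.space 0}
    (hx : x ∈ M.armSubspace i) : φ x ∈ N.armSubspace i := by
  cases hd : d i
  · rw [mem_armSubspace_of_false _ hd] at hx ⊢
    obtain ⟨y, rfl⟩ := hx
    exact ⟨ψ y, (h.2 hd y).symm⟩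
  · rw [mem_armSubspace_of_true _ hd] at hx ⊢
    rw [← h.1, hx, map_zero]

theorem ArmComm.leaf_unique (hM : M.RegularAt i) (hN : N.RegularAt i)
    {φ : M.space 0 →ₗ[k] N.space 0} {ψ ψ' : M.space i.succ →ₗ[k] N.space i.succ}
    (h : ArmComm M N i φ ψ) (h' : ArmComm M N i φ ψ') : ψ = ψ' := by
  ext x
  cases hd : d i
  · exact hN.2 hd (by rw [← h.2, ← h'.2])
  · obtain ⟨y, rfl⟩ := hM.1 hd x
    rw [h.1, h'.1]

theorem exists_armComm (hM : M.RegularAt i) (hN : N.RegularAt i)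
    {φ : M.space 0 →ₗ[k] N.space 0} (hφ : ∀ x ∈ M.armSubspace i, φ x ∈ N.armSubspace i) :
    ∃ ψ, ArmComm M N i φ ψ := by
  cases hd : d i
  · obtain ⟨g, hg⟩ := (N.inArm hd).exists_leftInverse_of_injective
      (LinearMap.ker_eq_bot.mpr (hN.2 hd))
    refine ⟨g ∘ₗ φ ∘ₗ M.inArm hd, by simp [hd], fun _ x => ?_⟩
    obtain ⟨y, hy⟩ := (mem_armSubspace_of_false _ hd).mp
      (hφ _ ((mem_armSubspace_of_false _ hd).mpr ⟨x, rfl⟩))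
    have := LinearMap.congr_fun hg y
    simp only [LinearMap.comp_apply, LinearMap.id_apply] at this ⊢
    rw [← hy, this]
  · obtain ⟨g, hg⟩ := (M.outArm hd).exists_rightInverse_of_surjective
      (LinearMap.range_eq_top.mpr (hM.1 hd))
    refine ⟨N.outArm hd ∘ₗ φ ∘ₗ g, fun _ x => ?_, by simp [hd]⟩
    have hx := hφ (g (M.outArm hd x) - x) ((mem_armSubspace_of_true _ hd).mpr (by
      rw [map_sub, sub_eq_zero]
      exact LinearMap.congr_fun hg _))
    rw [mem_armSubspace_of_true _ hd, map_sub, map_sub, sub_eq_zero] at hx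
    exact hx

/-- A linear isomorphism of central spaces matching the arm subspaces extends to an isomorphism
of regular representations. -/
theorem nonempty_iso_of_regularAt (hM : ∀ i, M.RegularAt i) (hN : ∀ i, N.RegularAt i)
    (φ : M.space 0 ≃ₗ[k] N.space 0)
    (hφ : ∀ i x, φ x ∈ N.armSubspace i ↔ x ∈ M.armSubspace i) : Nonempty (Iso M N) := by
  have h₁ : ∀ i, ∀ x ∈ M.armSubspace i, φ.toLinearMap x ∈ N.armSubspace i :=
    fun i x => (hφ i x).mpr
  have h₂ : ∀ i, ∀ x ∈ N.armSubspace i, φ.symm.toLinearMap x ∈ M.armSubspace i :=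
    fun i x hx => (hφ i _).mp (by simpa using hx)
  choose ψ hψ using fun i => exists_armComm (hM i) (hN i) (h₁ i)
  choose ψ' hψ' using fun i => exists_armComm (hN i) (hM i) (h₂ i)
  let e : ∀ i : Fin 3, M.space i.succ ≃ₗ[k] N.space i.succ := fun i =>
    LinearEquiv.ofLinearMap (ψ i) (ψ' i)
      (((hψ i).comp (hψ' i)).leaf_unique (hN i) (hN i) (by simpa using ArmComm.id))
      (((hψ' i).comp (hψ i)).leaf_unique (hM i) (hM i) (by simpa using ArmComm.id))
  let app : ∀ v, M.space v ≃ₗ[k] N.space v :=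
    Fin.cons (α := fun v => M.space v ≃ₗ[k] N.space v) φ e
  exact ⟨⟨app, fun i => (comm_iff_armComm fun v => (app v).toLinearMap).mpr (hψ i)⟩⟩

/-- In an indecomposable representation with regular arms, an idempotent of the central space
preserving the arm subspaces is trivial. -/
theorem Indecomposable.eq_zero_or_eq_id (hM : M.Indecomposable) (hr : ∀ i, M.RegularAt i)
    {p : M.space 0 →ₗ[k] M.space 0} (hp : p ∘ₗ p = p)
    (hU : ∀ i, ∀ x ∈ M.armSubspace i, p x ∈ M.armSubspace i) : p = 0 ∨ p = LinearMap.id := by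
  choose q hq using fun i => exists_armComm (hr i) (hr i) (hU i)
  let P : ∀ v, M.space v →ₗ[k] M.space v :=
    Fin.cons (α := fun v => M.space v →ₗ[k] M.space v) p q
  have hq' : ∀ i, q i ∘ₗ q i = q i := fun i =>
    ((hq i).comp (hq i)).leaf_unique (hr i) (hr i) (by rw [hp]; exact hq i)
  have h := ((indecomposable_iff_idempotent M).mp hM).2 P
    (Fin.cases (LinearMap.congr_fun hp) fun i => LinearMap.congr_fun (hq' i))
    (fun i => (comm_iff_armComm P).mpr (hq i))
  exact h.imp (fun h => LinearMap.ext (h 0)) fun h => LinearMap.ext (h 0)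

theorem indecomposable_of_regularAt [Nontrivial (M.space 0)] (hr : ∀ i, M.RegularAt i)
    (H : ∀ p : M.space 0 →ₗ[k] M.space 0, p ∘ₗ p = p →
      (∀ i, ∀ x ∈ M.armSubspace i, p x ∈ M.armSubspace i) → p = 0 ∨ p = LinearMap.id) :
    M.Indecomposable := by
  refine (indecomposable_iff_idempotent M).mpr ⟨fun h => ?_, fun p hp hc => ?_⟩
  · obtain ⟨x, hx⟩ := exists_ne (0 : M.space 0)
    exact hx (h 0 x)
  have hc' := fun i => (comm_iff_armComm p).mp (hc i)
  refine (H (p 0) (LinearMap.ext (hp 0)) fun i x hx => (hc' i).map_mem hx).imp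
    (fun h => Fin.cases (LinearMap.congr_fun h) fun i =>
      LinearMap.congr_fun (g := 0) ?_)
    (fun h => Fin.cases (LinearMap.congr_fun h) fun i =>
      LinearMap.congr_fun (g := LinearMap.id) ?_)
  · refine (hc' i).leaf_unique (ψ' := 0) (hr i) (hr i) ?_
    rw [h]
    exact ⟨by simp, by simp⟩
  · refine (hc' i).leaf_unique (ψ' := LinearMap.id) (hr i) (hr i) ?_
    rw [h]
    exact ArmComm.id

/-- An idempotent of rank one at a leaf, compatible with the arm, forces an indecomposable
representation to be thin. -/
theorem Indecomposable.thin_of_leaf (hM : M.Indecomposable) {x : M.space i.succ}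
    {g : M.space i.succ →ₗ[k] k} (hx : g x = 1)
    (hc : ArmComm M M i 0 (g.smulRight x)) : M.Thin := by
  classical
  let p : ∀ v, M.space v →ₗ[k] M.space v :=
    Fin.cons (α := fun v => M.space v →ₗ[k] M.space v) 0
      (Function.update (fun _ => 0) i (g.smulRight x))
  have hpi : p i.succ = g.smulRight x := by simp [p]
  have hpj : ∀ j, j ≠ i → p j.succ = 0 := fun j hj => by simp [p, hj]
  have hp₀ : p 0 = 0 := rfl
  have h := ((indecomposable_iff_idempotent M).mp hM).2 p ?_ ?_
  · rcases h with h | h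
    · have := h i.succ x
      rw [hpi] at this
      simp only [LinearMap.smulRight_apply, hx, one_smul] at this
      simp [this] at hx
    · have hz : ∀ v, p v = 0 → Module.rank k (M.space v) ≤ 1 := fun v hv => by
        refine rank_le_one_iff.mpr ⟨0, fun y => ⟨0, ?_⟩⟩
        rw [← h v y, hv]
        simp
      refine Fin.cases (hz 0 hp₀) fun j => ?_
      by_cases hj : j = i
      · subst hj
        refine rank_le_one_iff.mpr ⟨x, fun y => ⟨g y, ?_⟩⟩
        rw [← LinearMap.smulRight_apply, ← hpi, h]
      · exact hz _ (hpj j hj)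
  · refine Fin.cases (by simp [hp₀]) fun j y => ?_
    by_cases hj : j = i
    · subst hj
      simp [hpi, hx]
    · simp [hpj j hj]
  · intro j
    refine (comm_iff_armComm p).mpr ?_
    rw [hp₀]
    by_cases hj : j = i
    · subst hj
      rwa [hpi]
    · rw [hpj j hj]
      exact ⟨by simp, by simp⟩

theorem exists_functional_of_notMem {V : Type} [AddCommGroup V] [Module k V] {W : Submodule k V}
    {x : V} (hx : x ∉ W) : ∃ g : V →ₗ[k] k, g x = 1 ∧ ∀ y ∈ W, g y = 0 := by
  obtain ⟨g, hg, hW⟩ := Submodule.exists_le_ker_of_notMem hx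
  refine ⟨(g x)⁻¹ • g, by simp [hg], fun y hy => ?_⟩
  have : g y = 0 := hW hy
  simp [this]

theorem Indecomposable.regularAt (hM : M.Indecomposable) (ht : ¬ M.Thin) (i : Fin 3) :
    M.RegularAt i := by
  refine ⟨fun h => ?_, fun h => ?_⟩ <;> by_contra hc <;> apply ht
  · obtain ⟨x, hx⟩ : ∃ x, x ∉ LinearMap.range (M.outArm h) := by
      simpa [Function.Surjective] using hc
    obtain ⟨g, hg, hW⟩ := exists_functional_of_notMem hx
    exact hM.thin_of_leaf hg ⟨fun _ y => by simp [hW _ ⟨y, rfl⟩], by simp [h]⟩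
  · obtain ⟨x, hx, hx'⟩ : ∃ x, M.inArm h x = 0 ∧ x ≠ 0 := by
      simpa [injective_iff_map_eq_zero] using hc
    obtain ⟨g, hg, -⟩ := exists_functional_of_notMem (k := k) (W := ⊥) (by simpa using hx')
    exact hM.thin_of_leaf hg ⟨by simp [h], fun _ y => by simp [hx]⟩

theorem thin_of_rank_center_le_one (hr : ∀ i, M.RegularAt i)
    (h : Module.rank k (M.space 0) ≤ 1) : M.Thin := by
  refine Fin.cases h fun i => le_trans ?_ h
  cases hd : d i
  · exact LinearMap.rank_le_of_injective _ ((hr i).2 hd)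
  · exact (M.outArm hd).rank_le_of_surjective ((hr i).1 hd)

/-- The three coordinate subspaces `W × 0`, `0 × W` and the diagonal of `W × W`. -/
def lines (k W : Type) [Field k] [AddCommGroup W] [Module k W] : Fin 3 → Submodule k (W × W) :=
  ![LinearMap.range (LinearMap.inl k W W), LinearMap.range (LinearMap.inr k W W),
    LinearMap.range (LinearMap.id.prod LinearMap.id : W →ₗ[k] W × W)]

section Lines

variable {V W W' : Type} [AddCommGroup V] [Module k V] [AddCommGroup W] [Module k W]
  [AddCommGroup W'] [Module k W']

theorem mem_lines_zero {x : W × W} : x ∈ lines k W 0 ↔ x.2 = 0 := by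
  obtain ⟨x, y⟩ := x
  simp [lines, eq_comm]

theorem mem_lines_one {x : W × W} : x ∈ lines k W 1 ↔ x.1 = 0 := by
  obtain ⟨x, y⟩ := x
  simp [lines, eq_comm]

theorem mem_lines_two {x : W × W} : x ∈ lines k W 2 ↔ x.1 = x.2 := by
  obtain ⟨x, y⟩ := x
  simp [lines]

theorem prodMap_mem_lines (q : W →ₗ[k] W') {i : Fin 3} {x : W × W} (hx : x ∈ lines k W i) :
    q.prodMap q x ∈ lines k W' i := by
  fin_cases i <;> obtain ⟨y, rfl⟩ := hx
  exacts [⟨q y, by simp⟩, ⟨q y, by simp⟩, ⟨q y, by simp⟩]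

theorem prodCongr_mem_lines (q : W ≃ₗ[k] W') {i : Fin 3} {x : W × W} :
    q.prodCongr q x ∈ lines k W' i ↔ x ∈ lines k W i :=
  ⟨fun h => by simpa using prodMap_mem_lines q.symm.toLinearMap h,
    prodMap_mem_lines q.toLinearMap⟩

/-- Three pairwise complementary subspaces are the coordinate subspaces and the diagonal of a
square. -/
theorem exists_equiv_lines {U : Fin 3 → Submodule k V}
    (hU : ∀ i j, i ≠ j → IsCompl (U i) (U j)) :
    ∃ e : (U 0 × U 0) ≃ₗ[k] V, ∀ i x, e x ∈ U i ↔ x ∈ lines k (U 0) i := by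
  let f₀ := Submodule.quotientEquivOfIsCompl (U 2) (U 0) (hU 2 0 (by decide))
  let f₁ := Submodule.quotientEquivOfIsCompl (U 2) (U 1) (hU 2 1 (by decide))
  let ψ : U 0 ≃ₗ[k] U 1 := f₀.symm.trans f₁
  have hψ : ∀ x : U 0, (x : V) - ψ x ∈ U 2 := fun x => by
    rw [← Submodule.Quotient.eq]
    have h₀ : f₀.symm x = Submodule.Quotient.mk (x : V) := by simp [f₀]
    have h₁ : f₁.symm (ψ x) = Submodule.Quotient.mk (ψ x : V) := by simp [f₁]
    rw [← h₀, ← h₁]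
    simp [ψ]
  let e : (U 0 × U 0) ≃ₗ[k] V :=
    (LinearEquiv.prodCongr (LinearEquiv.refl k _) (ψ.trans (LinearEquiv.neg k))).trans
      (Submodule.prodEquivOfIsCompl _ _ (hU 0 1 (by decide)))
  have he : ∀ x y, e (x, y) = (x : V) - ψ y := fun x y => by simp [e, sub_eq_add_neg]
  refine ⟨e, fun i ⟨x, y⟩ => ?_⟩
  rw [he]
  fin_cases i
  · refine Iff.trans ?_ mem_lines_zero.symm
    rw [← map_eq_zero_iff ψ ψ.injective, ← Submodule.coe_eq_zero]
    refine (Submodule.sub_mem_iff_right _ x.2).trans ⟨fun h => ?_, fun h => h ▸ zero_mem _⟩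
    exact Submodule.disjoint_def.mp (hU 0 1 (by decide)).disjoint _ h (ψ y).2
  · refine Iff.trans ?_ mem_lines_one.symm
    rw [← Submodule.coe_eq_zero]
    refine (Submodule.sub_mem_iff_left _ (ψ y).2).trans ⟨fun h => ?_, fun h => h ▸ zero_mem _⟩
    exact Submodule.disjoint_def.mp (hU 0 1 (by decide)).disjoint _ x.2 h
  · refine Iff.trans ?_ mem_lines_two.symm
    refine ⟨fun h => ψ.injective (Subtype.ext (sub_eq_zero.mp ?_)), fun h => ?_⟩
    · refine Submodule.disjoint_def.mp (hU 1 2 (by decide)).disjoint _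
        (sub_mem (ψ x).2 (ψ y).2) ?_
      simpa using sub_mem h (hψ x)
    · obtain rfl : x = y := h
      exact hψ x

end Lines

/-- If no rank-one idempotent of `V` preserves all three subspaces, these are pairwise
complementary. -/
theorem isCompl_of_forall_mem {V : Type} [AddCommGroup V] [Module k V]
    {U : Fin 3 → Submodule k V}
    (H : ∀ (x : V) (W : Submodule k V), (∀ i, x ∈ U i ∨ U i ≤ W) → x ∈ W)
    (i j : Fin 3) (hij : i ≠ j) : IsCompl (U i) (U j) := by
  obtain ⟨l, hl⟩ : ∃ l : Fin 3, ∀ m, m = i ∨ m = j ∨ m = l := by decide +revert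
  constructor
  · rw [Submodule.disjoint_def]
    intro x hi hj
    have hxl : x ∈ U l := H x _ fun m => by
      rcases hl m with rfl | rfl | rfl
      exacts [.inl hi, .inl hj, .inr le_rfl]
    refine (Submodule.mem_bot k).mp (H x ⊥ fun m => ?_)
    rcases hl m with rfl | rfl | rfl
    exacts [.inl hi, .inl hj, .inl hxl]
  · have hlW : U l ≤ U i ⊔ U j := fun x hx => H x _ fun m => by
      rcases hl m with rfl | rfl | rfl
      exacts [.inr le_sup_left, .inr le_sup_right, .inl hx]
    rw [codisjoint_iff, eq_top_iff]
    refine fun x _ => H x _ fun m => .inr ?_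
    rcases hl m with rfl | rfl | rfl
    exacts [le_sup_left, le_sup_right, hlW]

/-- A square-zero endomorphism of `k × k` whose kernel and range are both the `i`-th line. -/
def lineNilpotent (k : Type) [Field k] : Fin 3 → (k × k →ₗ[k] k × k) :=
  ![LinearMap.inl k k k ∘ₗ LinearMap.snd k k k, LinearMap.inr k k k ∘ₗ LinearMap.fst k k k,
    (LinearMap.id.prod LinearMap.id) ∘ₗ (LinearMap.fst k k k - LinearMap.snd k k k)]

theorem ker_lineNilpotent (i : Fin 3) : LinearMap.ker (lineNilpotent k i) = lines k k i := by
  ext x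
  rw [LinearMap.mem_ker]
  fin_cases i
  · exact Iff.trans (by simp [lineNilpotent]) mem_lines_zero.symm
  · exact Iff.trans (by simp [lineNilpotent]) mem_lines_one.symm
  · exact Iff.trans (by simp [lineNilpotent, sub_eq_zero]) mem_lines_two.symm

theorem range_lineNilpotent (i : Fin 3) : LinearMap.range (lineNilpotent k i) = lines k k i := by
  fin_cases i
  · exact LinearMap.range_comp_of_range_eq_top _ (LinearMap.range_eq_top.mpr Prod.snd_surjective)
  · exact LinearMap.range_comp_of_range_eq_top _ (LinearMap.range_eq_top.mpr Prod.fst_surjective)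
  · exact LinearMap.range_comp_of_range_eq_top _
      (LinearMap.range_eq_top.mpr fun x => ⟨(x, 0), by simp⟩)

theorem finrank_lines (i : Fin 3) : Module.finrank k (lines k k i) = 1 := by
  fin_cases i
  · exact (LinearMap.finrank_range_of_inj LinearMap.inl_injective).trans (Module.finrank_self k)
  · exact (LinearMap.finrank_range_of_inj LinearMap.inr_injective).trans (Module.finrank_self k)
  · refine (LinearMap.finrank_range_of_inj fun x y h => ?_).trans (Module.finrank_self k)
    exact congrArg Prod.fst h

/-- The representation of `D₄` given by three distinct lines in a plane. -/
def threeLines (k : Type) [Field k] (d : Fin 3 → Bool) : QRep k (sD d) (tD d) where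
  space v := (Fin.cons ⊤ (lines k k) : Fin 4 → Submodule k (k × k)) v
  map i := (if d i then lineNilpotent k i else LinearMap.id).restrict (by
    intro x hx
    cases h : d i
    · simp [tD, h]
    · simp [tD, h, ← range_lineNilpotent])

theorem coe_arrow_threeLines {i : Fin 3} {a b : Fin 4} (hs : sD d i = a) (ht : tD d i = b)
    (x : (threeLines k d).space a) :
    ((threeLines k d).arrow hs ht x).val =
      (if d i then lineNilpotent k i else LinearMap.id) x.val := by
  subst hs ht
  rfl

theorem coe_outArm_threeLines {i : Fin 3} (h : d i = true) (x : (threeLines k d).space 0) :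
    ((threeLines k d).outArm h x).val = lineNilpotent k i x.val := by
  simp [outArm, coe_arrow_threeLines, h]

theorem coe_inArm_threeLines {i : Fin 3} (h : d i = false) (x : (threeLines k d).space i.succ) :
    ((threeLines k d).inArm h x).val = x.val := by
  simp [inArm, coe_arrow_threeLines, h]

theorem mem_armSubspace_threeLines {i : Fin 3} {x : (threeLines k d).space 0} :
    x ∈ (threeLines k d).armSubspace i ↔ x.val ∈ lines k k i := by
  cases h : d i
  · rw [mem_armSubspace_of_false _ h]
    constructor
    · rintro ⟨y, rfl⟩
      rw [coe_inArm_threeLines]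
      exact y.2
    · exact fun hx => ⟨⟨x.val, hx⟩, Subtype.ext (coe_inArm_threeLines h _)⟩
  · rw [mem_armSubspace_of_true _ h, ← ker_lineNilpotent, LinearMap.mem_ker,
      ← coe_outArm_threeLines h]
    exact Subtype.ext_iff

theorem regularAt_threeLines (i : Fin 3) : (threeLines k d).RegularAt i := by
  refine ⟨fun h y => ?_, fun h x y hxy => Subtype.ext ?_⟩
  · obtain ⟨x, hx⟩ : y.val ∈ LinearMap.range (lineNilpotent k i) := by
      rw [range_lineNilpotent]
      exact y.2
    exact ⟨⟨x, Submodule.mem_top⟩, Subtype.ext ((coe_outArm_threeLines h _).trans hx)⟩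
  · rw [← coe_inArm_threeLines h x, hxy, coe_inArm_threeLines h y]

/-- The center of `threeLines` is the plane `k × k`. -/
def threeLinesCenter (k : Type) [Field k] (d : Fin 3 → Bool) :
    (k × k) ≃ₗ[k] (threeLines k d).space 0 :=
  Submodule.topEquiv.symm

/-- An endomorphism of the plane preserving three distinct lines is scalar. -/
theorem exists_eq_smul_of_mem_lines {p : k × k →ₗ[k] k × k}
    (hp : ∀ i, ∀ x ∈ lines k k i, p x ∈ lines k k i) : ∃ c : k, ∀ x, p x = c • x := by
  obtain ⟨a, ha⟩ := hp 0 (1, 0) ⟨1, rfl⟩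
  obtain ⟨b, hb⟩ := hp 1 (0, 1) ⟨1, rfl⟩
  obtain ⟨c, hc⟩ := hp 2 (1, 1) ⟨1, rfl⟩
  refine ⟨c, fun x => ?_⟩
  have h : p (1, 1) = p (1, 0) + p (0, 1) := by rw [← map_add]; simp
  rw [← ha, ← hb, ← hc] at h
  obtain ⟨rfl, rfl⟩ : c = a ∧ c = b := by simpa using h
  have hx : x = x.1 • (1, 0) + x.2 • (0, 1) := by ext <;> simp
  conv_lhs => rw [hx, map_add, map_smul, map_smul, ← ha, ← hb]
  ext <;> simp [mul_comm]

theorem indecomposable_threeLines : (threeLines k d).Indecomposable := by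
  let e := threeLinesCenter k d
  have : Nontrivial ((threeLines k d).space 0) := e.symm.toEquiv.nontrivial
  refine indecomposable_of_regularAt regularAt_threeLines fun p hp hU => ?_
  obtain ⟨c, hc⟩ := exists_eq_smul_of_mem_lines
    (p := e.symm.toLinearMap ∘ₗ p ∘ₗ e.toLinearMap) fun i x hx =>
      mem_armSubspace_threeLines.mp (hU i (e x) (mem_armSubspace_threeLines.mpr hx))
  have hpc : ∀ x, p x = c • x := fun x => by
    have := hc (e.symm x)
    apply e.symm.injective
    simpa using this
  obtain ⟨x, hx⟩ := exists_ne (0 : (threeLines k d).space 0)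
  have hcc : c * c = c := by
    have := LinearMap.congr_fun hp x
    rw [LinearMap.comp_apply, hpc, hpc, smul_smul] at this
    exact smul_left_injective k hx this
  rcases IsIdempotentElem.iff_eq_zero_or_one.mp hcc with rfl | rfl
  · exact .inl (LinearMap.ext fun x => by simp [hpc])
  · exact .inr (LinearMap.ext fun x => by simp [hpc])

/-- A rank-one idempotent of the center preserving the arm subspaces forces an indecomposable
representation to be thin. -/
theorem Indecomposable.thin_of_center (hM : M.Indecomposable) (hr : ∀ i, M.RegularAt i)
    {x : M.space 0} {g : M.space 0 →ₗ[k] k} (hx : g x = 1)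
    (h : ∀ i, x ∈ M.armSubspace i ∨ M.armSubspace i ≤ LinearMap.ker g) : M.Thin := by
  have hgx : ∀ y, g.smulRight x y = g y • x := fun y => rfl
  refine thin_of_rank_center_le_one hr (rank_le_one_iff.mpr ⟨x, fun y => ⟨g y, ?_⟩⟩)
  have hp : g.smulRight x ∘ₗ g.smulRight x = g.smulRight x :=
    LinearMap.ext fun y => by
      rw [LinearMap.comp_apply, hgx (g.smulRight x y), hgx y, map_smul, hx, smul_eq_mul, mul_one]
  have hU : ∀ i, ∀ y ∈ M.armSubspace i, g.smulRight x y ∈ M.armSubspace i := fun i y hy => by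
    rcases h i with hi | hi
    · exact Submodule.smul_mem _ _ hi
    · rw [hgx, LinearMap.mem_ker.mp (hi hy), zero_smul]
      exact zero_mem _
  rcases hM.eq_zero_or_eq_id hr hp hU with h₀ | h₁
  · have hx₀ : x = 0 := by
      have := LinearMap.congr_fun h₀ x
      rwa [hgx, hx, one_smul] at this
    simp [hx₀] at hx
  · rw [← hgx, h₁, LinearMap.id_apply]

/-- A non-thin indecomposable representation is isomorphic to `threeLines`. -/
theorem Indecomposable.nonempty_iso_threeLines (hM : M.Indecomposable) (ht : ¬ M.Thin) :
    Nonempty (Iso M (threeLines k d)) := by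
  have hr := hM.regularAt ht
  have hU : ∀ i j, i ≠ j → IsCompl (M.armSubspace i) (M.armSubspace j) := by
    refine isCompl_of_forall_mem fun x W hW => ?_
    by_contra hx
    obtain ⟨g, hg, hgW⟩ := exists_functional_of_notMem hx
    exact ht (hM.thin_of_center hr hg fun i => (hW i).imp_right fun h y hy => hgW y (h hy))
  obtain ⟨e, he⟩ := exists_equiv_lines hU
  obtain ⟨x, hx⟩ : ∃ x : M.armSubspace 0, x ≠ 0 := by
    by_contra! h
    refine ht (thin_of_rank_center_le_one hr (rank_le_one_iff.mpr ⟨0, fun v => ⟨0, ?_⟩⟩))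
    have : e.symm v = 0 := Prod.ext (h _) (h _)
    rw [zero_smul, ← e.apply_symm_apply v, this, map_zero]
  obtain ⟨g, hg, -⟩ := exists_functional_of_notMem (k := k) (W := ⊥) (by simpa using hx)
  let q : M.armSubspace 0 →ₗ[k] M.armSubspace 0 := g.smulRight x
  let p : M.space 0 →ₗ[k] M.space 0 := e.toLinearMap ∘ₗ q.prodMap q ∘ₗ e.symm.toLinearMap
  have hp : p ∘ₗ p = p := LinearMap.ext fun y => by simp [p, q, hg]
  have hpU : ∀ i, ∀ y ∈ M.armSubspace i, p y ∈ M.armSubspace i := by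
    intro i y hy
    obtain ⟨z, rfl⟩ := e.surjective y
    have := prodMap_mem_lines q ((he i z).mp hy)
    simpa [p, he] using this
  have hq : ∀ y, g y • x = y := by
    rcases hM.eq_zero_or_eq_id hr hp hpU with h | h
    · have := LinearMap.congr_fun h (e (x, x))
      simp [p, q, hg, hx] at this
    · intro y
      have := LinearMap.congr_fun h (e (y, y))
      simpa [p, q] using this
  let a : k ≃ₗ[k] M.armSubspace 0 :=
    { LinearMap.toSpanSingleton k _ x with
      invFun := g
      left_inv := fun c => by simp [hg]
      right_inv := hq }
  refine nonempty_iso_of_regularAt hr regularAt_threeLines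
    ((e.symm.trans (a.symm.prodCongr a.symm)).trans (threeLinesCenter k d)) fun i y => ?_
  obtain ⟨z, rfl⟩ := e.surjective y
  rw [mem_armSubspace_threeLines, he, ← prodCongr_mem_lines a.symm]
  rw [LinearEquiv.trans_apply, LinearEquiv.trans_apply, e.symm_apply_apply]
  rfl

end D4

end QRep

/-- A quiver of type `D₄` (any orientation) has, up to isomorphism,
exactly one indecomposable representation that is not thin, namely one with dimension
vector `2` at the center and `1` at the three leaves. -/
theorem stmt10 (k : Type) [Field k] (d : Fin 3 → Bool) :
    ∃ M₀ : QRep k (sD d) (tD d),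
      M₀.FinDim ∧
      Module.finrank k (M₀.space 0) = 2 ∧
      (∀ j : Fin 3, Module.finrank k (M₀.space j.succ) = 1) ∧
      M₀.Indecomposable ∧ ¬ M₀.Thin ∧
      (∀ N : QRep k (sD d) (tD d), N.FinDim → N.Indecomposable → ¬ N.Thin →
        Nonempty (QRep.Iso N M₀)) := by
  have h₀ : Module.finrank k ((QRep.threeLines k d).space 0) = 2 := by
    rw [← (QRep.threeLinesCenter k d).finrank_eq]
    simp
  refine ⟨QRep.threeLines k d, fun v => ?_, h₀, QRep.finrank_lines,
    QRep.indecomposable_threeLines, fun h => ?_, fun N _ hN ht => hN.nonempty_iso_threeLines ht⟩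
  · exact FiniteDimensional.finiteDimensional_submodule _
  · have := Module.finrank_le_of_rank_le (n := 1) (by simpa using h 0)
    omega
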